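/- Let n ≥ 1 and define the viscous stress tensor 𝒵₀'(F,Q) = 2(det F) sym(QF^{-1}) F^{-1,T} for invertible real n×n matrices F and arbitrary real n×n matrices Q. Then 𝒵₀' satisfies the three principles (1.5): (i) balance of angular momentum: F^{-1}𝒵₀'(F,Q) is symmetric; (ii) frame invariance: for every R ∈ SO(n) and every skew-symmetric real n×n matrix K, 𝒵₀'(RF, RKF + RQ) = R·𝒵₀'(F,Q); (iii) Clausius–Duhem inequality: if det F > 0 then ⟨𝒵₀'(F,Q) : Q⟩ = 2(det F)|sym(QF^{-1})|² ≥ 0. -/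

import Mathlib

open Matrix

/-- The Frobenius inner product `⟨A : B⟩ = tr(Aᵀ B)`. -/
noncomputable def mip {n : ℕ} (A B : Matrix (Fin n) (Fin n) ℝ) : ℝ :=
  (Aᵀ * B).trace

/-- The symmetric part `sym F = (F + Fᵀ)/2`. -/
noncomputable def msym {n : ℕ} (A : Matrix (Fin n) (Fin n) ℝ) : Matrix (Fin n) (Fin n) ℝ :=
  (2 : ℝ)⁻¹ • (A + Aᵀ)

/-- The viscous stress tensor `𝒵₀'(F,Q) = 2 (det F) sym(QF⁻¹) F^{-1,T}`. -/
noncomputable def Z0' {n : ℕ} (F Q : Matrix (Fin n) (Fin n) ℝ) :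
    Matrix (Fin n) (Fin n) ℝ :=
  (2 * F.det) • (msym (Q * F⁻¹) * F⁻¹ᵀ)

theorem transpose_msym {n : ℕ} (A : Matrix (Fin n) (Fin n) ℝ) : (msym A)ᵀ = msym A := by
  simp [msym, add_comm]

theorem msym_conj {n : ℕ} (R A : Matrix (Fin n) (Fin n) ℝ) :
    msym (R * A * Rᵀ) = R * msym A * Rᵀ := by
  simp [msym, Matrix.mul_add, Matrix.add_mul, Matrix.mul_assoc]

theorem msym_skew_add {n : ℕ} {K : Matrix (Fin n) (Fin n) ℝ} (hK : Kᵀ = -K)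
    (A : Matrix (Fin n) (Fin n) ℝ) : msym (K + A) = msym A := by
  simp only [msym, transpose_add, hK]
  congr 1
  abel

theorem mip_self_nonneg {n : ℕ} (A : Matrix (Fin n) (Fin n) ℝ) : 0 ≤ mip A A := by
  simp only [mip, trace, diag_apply, mul_apply, transpose_apply]
  exact Finset.sum_nonneg fun _ _ => Finset.sum_nonneg fun _ _ => mul_self_nonneg _

theorem mip_msym_self {n : ℕ} (A : Matrix (Fin n) (Fin n) ℝ) :
    mip (msym A) (msym A) = (msym A * A).trace := by
  have h : (msym A * Aᵀ).trace = (msym A * A).trace := by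
    rw [← trace_transpose, transpose_mul, transpose_transpose, transpose_msym, trace_mul_comm]
  rw [mip, transpose_msym]
  conv_lhs => rw [show msym A * msym A = (2 : ℝ)⁻¹ • (msym A * A + msym A * Aᵀ) by
    rw [← Matrix.mul_add, ← Matrix.mul_smul]; rfl]
  rw [trace_smul, trace_add, h, smul_eq_mul]
  ring

theorem stmt_12 {n : ℕ} (hn : 1 ≤ n)
    (F Q : Matrix (Fin n) (Fin n) ℝ) (hF : IsUnit F.det) :
    -- (i) balance of angular momentum: F⁻¹ 𝒵₀'(F,Q) is symmetric
    ((F⁻¹ * Z0' F Q)ᵀ = F⁻¹ * Z0' F Q) ∧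
    -- (ii) frame invariance
    (∀ R K : Matrix (Fin n) (Fin n) ℝ, Rᵀ * R = 1 → R.det = 1 → Kᵀ = -K →
      Z0' (R * F) (R * K * F + R * Q) = R * Z0' F Q) ∧
    -- (iii) Clausius–Duhem inequality
    (0 < F.det →
      mip (Z0' F Q) Q = 2 * F.det * mip (msym (Q * F⁻¹)) (msym (Q * F⁻¹)) ∧
      0 ≤ mip (Z0' F Q) Q) := by
  refine ⟨?_, ?_, ?_⟩
  · simp [Z0', transpose_msym, Matrix.mul_assoc]
  · intro R K hR hdet hK
    have hRinv : R⁻¹ = Rᵀ := inv_eq_left_inv hR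
    have hA : (R * K * F + R * Q) * (F⁻¹ * Rᵀ) = R * (K + Q * F⁻¹) * Rᵀ := by
      rw [← Matrix.mul_assoc, Matrix.add_mul, mul_nonsing_inv_cancel_right _ _ hF,
        Matrix.mul_add, Matrix.mul_assoc R Q]
    rw [Z0', Z0', det_mul, hdet, one_mul, Matrix.mul_inv_rev, hRinv, hA, msym_conj,
      msym_skew_add hK, transpose_mul, transpose_transpose, Matrix.mul_smul]
    congr 1
    rw [Matrix.mul_assoc _ Rᵀ, ← Matrix.mul_assoc Rᵀ, hR, Matrix.one_mul, Matrix.mul_assoc]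
  · intro hpos
    have key : mip (Z0' F Q) Q = 2 * F.det * mip (msym (Q * F⁻¹)) (msym (Q * F⁻¹)) := by
      rw [mip_msym_self, mip, Z0', transpose_smul, transpose_mul, transpose_transpose,
        transpose_msym, Matrix.smul_mul, trace_smul, smul_eq_mul, Matrix.mul_assoc,
        trace_mul_comm, Matrix.mul_assoc]
    refine ⟨key, ?_⟩
    rw [key]
    exact mul_nonneg (by positivity) (mip_self_nonneg _)
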